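/- arXiv:2003.12833 — 4 statements merged into one kernel-verified Lean document; each statement's English description precedes it below -/
import Mathlib

section
/- There exist absolute constants c > 0 and C ≥ 1 with the following property. For a ∈ (0, 1/3], let D_a ⊆ ℝ² be the trapezoid with vertices (−a,0), (a,0), (−1,1), (1,1) (i.e. the convex hull of these four points). Then for every integer n ≥ 1 and every δ with c·n⁻² ≤ δ ≤ 1/2: C⁻¹·n⁻²·√(δ·(a+δ)) ≤ λₙ((0,δ), D_a) ≤ C·n⁻²·√(δ·(a+δ)). -/
open MeasureTheory Set Pointwise

noncomputable section

abbrev E (d : ℕ) := EuclideanSpace ℝ (Fin d)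
abbrev E2 := EuclideanSpace ℝ (Fin 2)

/-- The Christoffel function `λ_n(x, D)` for Lebesgue measure on `D ⊆ ℝ^d`. -/
noncomputable def christoffel (d n : ℕ) (x : E d) (D : Set (E d)) : ℝ :=
  sInf { r : ℝ | ∃ p : MvPolynomial (Fin d) ℝ, p.totalDegree ≤ n ∧
    MvPolynomial.eval (fun i => x i) p = 1 ∧
    r = ∫ y in D, (MvPolynomial.eval (fun i => y i) p) ^ 2 }

/-- Determinant of the linear part of an affine automorphism of `ℝ^d`. -/
noncomputable def adet {d : ℕ} (T : E d ≃ᵃ[ℝ] E d) : ℝ :=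
  LinearMap.det (T.linear : E d →ₗ[ℝ] E d)

/-- The closed unit ball `B` of `ℝ²`. -/
def ballE : Set E2 := Metric.closedBall 0 1

/-- The unit square `S = [0,1]²` in `ℝ²`. -/
def squareS : Set E2 := {y : E2 | y 0 ∈ Icc (0:ℝ) 1 ∧ y 1 ∈ Icc (0:ℝ) 1}

/-- The geometric quantity `L(x, D)`. -/
noncomputable def Lfun (x : E2) (D : Set E2) : ℝ :=
  sSup { r : ℝ | ∃ T : E2 ≃ᵃ[ℝ] E2, x ∈ T '' ballE ∧ T '' ballE ⊆ D ∧
    r = Real.sqrt (1 - ‖T.symm x‖) * |adet T| }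

/-- The geometric quantity `U(x, D)`. -/
noncomputable def Ufun (x : E2) (D : Set E2) : ℝ :=
  sInf { r : ℝ | ∃ T : E2 ≃ᵃ[ℝ] E2, x ∈ T '' ((2:ℝ)⁻¹ • squareS) ∧ D ⊆ T '' squareS ∧
    r = Real.sqrt ((T.symm x) 0 * (T.symm x) 1) * |adet T| }

/-- A convex body in `ℝ²`: a compact convex set with nonempty interior. -/
def IsConvexBody (D : Set E2) : Prop := Convex ℝ D ∧ IsCompact D ∧ (interior D).Nonempty

/-- The point `(a, b)` of `ℝ²`. -/
noncomputable def e2 (a b : ℝ) : E2 := (WithLp.equiv 2 (Fin 2 → ℝ)).symm ![a, b]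

/-- A real function of the form `θ ↦ exp (-i N θ) P (exp (i θ))` with `P` a complex polynomial of
degree at most `2 N`, that is, a trigonometric polynomial of degree at most `N`. -/
def IsTrigPoly (N : ℕ) (f : ℝ → ℝ) : Prop :=
  ∃ P : Polynomial ℂ, P.natDegree ≤ 2 * N ∧
    ∀ θ : ℝ, (f θ : ℂ) * Complex.exp (θ * Complex.I) ^ N = P.eval (Complex.exp (θ * Complex.I))

namespace IsTrigPoly

theorem const (c : ℝ) : IsTrigPoly 0 fun _ => c :=
  ⟨Polynomial.C (c : ℂ), by simp, fun θ => by simp⟩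

theorem mono {N M : ℕ} {f : ℝ → ℝ} (hf : IsTrigPoly N f) (h : N ≤ M) : IsTrigPoly M f := by
  obtain ⟨P, hP, hfP⟩ := hf
  refine ⟨P * Polynomial.X ^ (M - N), ?_, fun θ => ?_⟩
  · refine Polynomial.natDegree_mul_le.trans ?_
    rw [Polynomial.natDegree_X_pow]
    omega
  · rw [Polynomial.eval_mul, ← hfP, Polynomial.eval_pow, Polynomial.eval_X, mul_assoc, ← pow_add,
      Nat.add_sub_cancel' h]

theorem add {N : ℕ} {f g : ℝ → ℝ} (hf : IsTrigPoly N f) (hg : IsTrigPoly N g) :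
    IsTrigPoly N fun θ => f θ + g θ := by
  obtain ⟨P, hP, hfP⟩ := hf
  obtain ⟨Q, hQ, hgQ⟩ := hg
  refine ⟨P + Q, Polynomial.natDegree_add_le_of_degree_le hP hQ, fun θ => ?_⟩
  rw [Polynomial.eval_add, ← hfP, ← hgQ]
  push_cast
  ring

theorem mul {N M : ℕ} {f g : ℝ → ℝ} (hf : IsTrigPoly N f) (hg : IsTrigPoly M g) :
    IsTrigPoly (N + M) fun θ => f θ * g θ := by
  obtain ⟨P, hP, hfP⟩ := hf
  obtain ⟨Q, hQ, hgQ⟩ := hg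
  refine ⟨P * Q, Polynomial.natDegree_mul_le.trans (by omega), fun θ => ?_⟩
  rw [Polynomial.eval_mul, ← hfP, ← hgQ]
  push_cast
  ring

theorem const_mul {N : ℕ} {f : ℝ → ℝ} (c : ℝ) (hf : IsTrigPoly N f) :
    IsTrigPoly N fun θ => c * f θ := by
  simpa using (const c).mul hf

theorem pow {N : ℕ} {f : ℝ → ℝ} (hf : IsTrigPoly N f) (k : ℕ) :
    IsTrigPoly (k * N) fun θ => f θ ^ k := by
  induction k with
  | zero => simpa using const 1
  | succ k ih => simpa [pow_succ, add_mul] using ih.mul hf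

theorem sum {ι : Type*} {N : ℕ} (s : Finset ι) (f : ι → ℝ → ℝ)
    (hf : ∀ i ∈ s, IsTrigPoly N (f i)) : IsTrigPoly N fun θ => ∑ i ∈ s, f i θ := by
  classical
  induction s using Finset.induction_on with
  | empty => simpa using (const 0).mono (Nat.zero_le N)
  | insert i s hi ih =>
    simp only [Finset.sum_insert hi]
    exact (hf i (by simp)).add (ih fun j hj => hf j (by simp [hj]))

theorem cos : IsTrigPoly 1 Real.cos := by
  refine ⟨Polynomial.C (1 / 2) * (Polynomial.X ^ 2 + 1), ?_, fun θ => ?_⟩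
  · compute_degree
  · have h : Complex.exp (-(θ * Complex.I)) * Complex.exp (θ * Complex.I) = 1 := by
      rw [← Complex.exp_add]; simp
    simp only [Complex.ofReal_cos, Complex.cos, Polynomial.eval_mul, Polynomial.eval_C,
      Polynomial.eval_add, Polynomial.eval_pow, Polynomial.eval_X, Polynomial.eval_one, neg_mul]
    linear_combination h / 2

theorem sin : IsTrigPoly 1 Real.sin := by
  refine ⟨Polynomial.C (Complex.I / 2) * (1 - Polynomial.X ^ 2), ?_, fun θ => ?_⟩
  · compute_degree
  · have h : Complex.exp (-(θ * Complex.I)) * Complex.exp (θ * Complex.I) = 1 := by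
      rw [← Complex.exp_add]; simp
    simp only [Complex.ofReal_sin, Complex.sin, Polynomial.eval_mul, Polynomial.eval_C,
      Polynomial.eval_sub, Polynomial.eval_pow, Polynomial.eval_X, Polynomial.eval_one, neg_mul]
    linear_combination Complex.I * h / 2

theorem mvPolynomial_eval {n : ℕ} {p : MvPolynomial (Fin 2) ℝ} (hp : p.totalDegree ≤ n)
    {x y : ℝ → ℝ} (hx : IsTrigPoly 1 x) (hy : IsTrigPoly 1 y) :
    IsTrigPoly n fun θ => MvPolynomial.eval ![x θ, y θ] p := by
  simp only [MvPolynomial.eval_eq', Fin.prod_univ_two, Matrix.cons_val_zero, Matrix.cons_val_one]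
  refine sum _ _ fun d hd => const_mul _ ?_
  refine ((hx.pow (d 0)).mul (hy.pow (d 1))).mono (le_trans ?_ hp)
  have := MvPolynomial.le_totalDegree hd
  rw [Finsupp.sum_fintype _ _ (by simp), Fin.sum_univ_two] at this
  omega

theorem polynomial_eval {n : ℕ} {q : Polynomial ℝ} (hq : q.natDegree ≤ n)
    {y : ℝ → ℝ} (hy : IsTrigPoly 1 y) : IsTrigPoly n fun θ => q.eval (y θ) := by
  simp only [Polynomial.eval_eq_sum_range]
  refine sum _ _ fun d hd => const_mul _ ((hy.pow d).mono ?_)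
  rw [Finset.mem_range] at hd
  omega

/-- Nikolskii's inequality between the uniform norm and the `L²` norm. -/
theorem sq_le_integral {N : ℕ} {f : ℝ → ℝ} (hf : IsTrigPoly N f) (θ₀ : ℝ) :
    f θ₀ ^ 2 ≤ (2 * N + 1) * ((2 * Real.pi)⁻¹ * ∫ θ in (-Real.pi)..Real.pi, f θ ^ 2) := by
  obtain ⟨P, hP, hfP⟩ := hf
  have hnorm (θ : ℝ) : f θ ^ 2 = ‖P.eval (Complex.exp (θ * Complex.I))‖ ^ 2 := by
    rw [← hfP, norm_mul, norm_pow, Complex.norm_exp_ofReal_mul_I]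
    simp
  have hint : (2 * Real.pi)⁻¹ * ∫ θ in (-Real.pi)..Real.pi, f θ ^ 2 =
      ∑ i ∈ P.support, ‖P.coeff i‖ ^ 2 := by
    rw [P.sum_sq_norm_coeff_eq_circleAverage, Real.circleAverage_def]
    have hper : Function.Periodic (fun θ => f θ ^ 2) (2 * Real.pi) := fun θ => by
      simp only [hnorm]
      push_cast
      rw [add_mul, Complex.exp_add, Complex.exp_two_pi_mul_I, mul_one]
    have h := hper.intervalIntegral_add_eq (-Real.pi) 0
    rw [show -Real.pi + 2 * Real.pi = Real.pi by ring, zero_add] at h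
    rw [h, smul_eq_mul]
    simp only [hnorm, circleMap, Complex.ofReal_one, one_mul, zero_add]
  rw [hint, hnorm, Polynomial.eval_eq_sum, Polynomial.sum]
  calc _ ≤ (∑ i ∈ P.support, ‖P.coeff i‖) ^ 2 := by
        gcongr
        refine (norm_sum_le _ _).trans (Finset.sum_le_sum fun i _ => ?_)
        rw [norm_mul, norm_pow, Complex.norm_exp_ofReal_mul_I]
        simp
    _ ≤ P.support.card * ∑ i ∈ P.support, ‖P.coeff i‖ ^ 2 := sq_sum_le_card_mul_sum_sq
    _ ≤ _ := by
        gcongr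
        have := P.card_supp_le_succ_natDegree
        have : P.support.card ≤ 2 * N + 1 := by omega
        exact_mod_cast this

end IsTrigPoly

/-- The Fejér kernel with period `π`, normalized to take the value `1` at `0`. -/
def fejer (m : ℕ) (φ : ℝ) : ℝ :=
  ((m : ℝ) ^ 2)⁻¹ * ∑ i ∈ Finset.range m, ∑ j ∈ Finset.range m, Real.cos (((i : ℤ) - j : ℤ) * (2 * φ))

theorem fejer_eq_normSq (m : ℕ) (φ : ℝ) : fejer m φ =
    ((m : ℝ) ^ 2)⁻¹ * ‖∑ j ∈ Finset.range m, Complex.exp (Complex.I * (2 * φ : ℝ)) ^ j‖ ^ 2 := by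
  rw [fejer]
  congr 1
  have h (j : ℕ) : Complex.exp (Complex.I * (2 * φ : ℝ)) ^ j =
      ⟨Real.cos (j * (2 * φ)), Real.sin (j * (2 * φ))⟩ := by
    rw [← Complex.exp_nat_mul, show (j : ℂ) * (Complex.I * (2 * φ : ℝ)) =
      ((j * (2 * φ) : ℝ) : ℂ) * Complex.I by push_cast; ring]
    apply Complex.ext
    · rw [Complex.exp_ofReal_mul_I_re]
    · rw [Complex.exp_ofReal_mul_I_im]
  simp only [h]
  rw [← Complex.normSq_eq_norm_sq, Complex.normSq_apply, Complex.re_sum, Complex.im_sum,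
    Finset.sum_mul_sum, Finset.sum_mul_sum, ← Finset.sum_add_distrib]
  refine Finset.sum_congr rfl fun i _ => ?_
  rw [← Finset.sum_add_distrib]
  refine Finset.sum_congr rfl fun j _ => ?_
  rw [← Real.cos_sub]
  push_cast
  ring_nf

theorem fejer_nonneg (m : ℕ) (φ : ℝ) : 0 ≤ fejer m φ := by
  rw [fejer_eq_normSq]
  positivity

theorem norm_sum_exp_pow_le (m : ℕ) (φ : ℝ) :
    ‖∑ j ∈ Finset.range m, Complex.exp (Complex.I * (2 * φ : ℝ)) ^ j‖ ≤ m := by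
  refine (norm_sum_le _ _).trans ?_
  simp [norm_pow, Complex.norm_exp_I_mul_ofReal, -Complex.ofReal_mul]

theorem fejer_le_one (m : ℕ) (φ : ℝ) : fejer m φ ≤ 1 := by
  rw [fejer_eq_normSq]
  calc _ ≤ ((m : ℝ) ^ 2)⁻¹ * (m : ℝ) ^ 2 := by gcongr; exact norm_sum_exp_pow_le m φ
    _ ≤ 1 := inv_mul_le_one

theorem fejer_mul_abs_sin_le (m : ℕ) (φ : ℝ) : fejer m φ * |Real.sin φ| ≤ (m : ℝ)⁻¹ := by
  rw [fejer_eq_normSq]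
  set z := Complex.exp (Complex.I * (2 * φ : ℝ)) with hz
  set S := ∑ j ∈ Finset.range m, z ^ j with hS
  have hz1 : ‖z‖ = 1 := Complex.norm_exp_I_mul_ofReal _
  have hle : ‖S‖ ≤ m := norm_sum_exp_pow_le m φ
  have h : ‖S‖ * |Real.sin φ| ≤ 1 := by
    have h1 : ‖z - 1‖ = 2 * |Real.sin φ| := by
      rw [hz, Complex.norm_exp_I_mul_ofReal_sub_one]
      simp
    have h2 : ‖S‖ * ‖z - 1‖ ≤ 2 := by
      rw [← norm_mul, hS, geom_sum_mul]
      refine (norm_sub_le _ _).trans ?_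
      rw [norm_pow, hz1]
      norm_num
    rw [h1] at h2
    linarith
  calc ((m : ℝ) ^ 2)⁻¹ * ‖S‖ ^ 2 * |Real.sin φ| =
      ((m : ℝ) ^ 2)⁻¹ * (‖S‖ * (‖S‖ * |Real.sin φ|)) := by ring
    _ ≤ ((m : ℝ) ^ 2)⁻¹ * (m * 1) := by gcongr
    _ = (m : ℝ)⁻¹ := by
      rcases eq_or_ne (m : ℝ) 0 with h | h
      · simp [h]
      · field_simp

theorem half_le_fejer {m : ℕ} (hm : 1 ≤ m) {φ : ℝ} (hφ : 2 * ((m : ℝ) - 1) * |φ| ≤ Real.pi / 3) :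
    1 / 2 ≤ fejer m φ := by
  have hm0 : (0 : ℝ) < m := by exact_mod_cast hm
  have hcos (i) (hi : i ∈ Finset.range m) (j) (hj : j ∈ Finset.range m) :
      1 / 2 ≤ Real.cos (((i : ℤ) - j : ℤ) * (2 * φ)) := by
    rw [Finset.mem_range] at hi hj
    have h1 : |(((i : ℤ) - j : ℤ) : ℝ)| ≤ m - 1 := by
      have : |(i : ℤ) - j| ≤ m - 1 := by rw [abs_le]; omega
      exact_mod_cast this
    rw [← Real.cos_abs, abs_mul, abs_mul, abs_two, ← Real.cos_pi_div_three]
    have h2 : |(((i : ℤ) - j : ℤ) : ℝ)| * (2 * |φ|) ≤ Real.pi / 3 := by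
      nlinarith [abs_nonneg φ]
    exact Real.cos_le_cos_of_nonneg_of_le_pi (by positivity) (by linarith [Real.pi_pos]) h2
  rw [fejer]
  calc (1 / 2 : ℝ) = ((m : ℝ) ^ 2)⁻¹ * ∑ i ∈ Finset.range m, ∑ j ∈ Finset.range m, (1 / 2 : ℝ) := by
        simp only [Finset.sum_const, Finset.card_range, nsmul_eq_mul]
        field_simp
    _ ≤ _ := by
      gcongr with i hi j hj
      exact hcos i hi j hj

/-- The polynomial whose value at `sin² θ` is the even part of the Fejér kernel centred at `θ₀`. -/
def fejerPoly (m : ℕ) (θ₀ : ℝ) : Polynomial ℝ :=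
  ∑ i ∈ Finset.range m, ∑ j ∈ Finset.range m,
    Polynomial.C (((m : ℝ) ^ 2)⁻¹ * Real.cos (((i : ℤ) - j : ℤ) * (2 * θ₀))) *
      (Polynomial.Chebyshev.T ℝ ((i : ℤ) - j)).comp (1 - 2 * Polynomial.X)

theorem natDegree_fejerPoly_le (m : ℕ) (θ₀ : ℝ) : (fejerPoly m θ₀).natDegree ≤ m - 1 := by
  refine Polynomial.natDegree_sum_le_of_forall_le _ _ fun i hi =>
    Polynomial.natDegree_sum_le_of_forall_le _ _ fun j hj => ?_
  refine (Polynomial.natDegree_C_mul_le _ _).trans (Polynomial.natDegree_comp_le.trans ?_)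
  rw [Polynomial.Chebyshev.natDegree_T]
  have h : (1 - 2 * Polynomial.X : Polynomial ℝ).natDegree ≤ 1 := by compute_degree
  rw [Finset.mem_range] at hi hj
  exact (Nat.mul_le_mul_left _ h).trans (by omega)

theorem eval_fejerPoly_eq_sum (m : ℕ) (θ₀ θ : ℝ) : (fejerPoly m θ₀).eval (Real.sin θ ^ 2) =
    ∑ i ∈ Finset.range m, ∑ j ∈ Finset.range m,
      ((m : ℝ) ^ 2)⁻¹ * Real.cos (((i : ℤ) - j : ℤ) * (2 * θ₀)) *
        Real.cos (((i : ℤ) - j : ℤ) * (2 * θ)) := by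
  have h : 1 - 2 * Real.sin θ ^ 2 = Real.cos (2 * θ) := by rw [Real.cos_two_mul, Real.sin_sq]; ring
  simp only [fejerPoly, Polynomial.eval_finsetSum, Polynomial.eval_mul, Polynomial.eval_C,
    Polynomial.eval_comp, Polynomial.eval_sub, Polynomial.eval_one, Polynomial.eval_X,
    Polynomial.eval_ofNat, h, Polynomial.Chebyshev.T_real_cos]

theorem eval_fejerPoly (m : ℕ) (θ₀ θ : ℝ) : (fejerPoly m θ₀).eval (Real.sin θ ^ 2) =
    (fejer m (θ - θ₀) + fejer m (θ + θ₀)) / 2 := by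
  rw [eval_fejerPoly_eq_sum, fejer, fejer, ← mul_add, ← Finset.sum_add_distrib, mul_div_assoc,
    Finset.sum_div, Finset.mul_sum]
  refine Finset.sum_congr rfl fun i _ => ?_
  rw [← Finset.sum_add_distrib, Finset.sum_div, Finset.mul_sum]
  refine Finset.sum_congr rfl fun j _ => ?_
  rw [mul_sub, mul_add, mul_sub, mul_add, Real.cos_sub, Real.cos_add]
  ring

theorem integral_eval_fejerPoly {m : ℕ} (hm : 1 ≤ m) (θ₀ : ℝ) :
    ∫ θ in (0 : ℝ)..Real.pi, (fejerPoly m θ₀).eval (Real.sin θ ^ 2) = Real.pi / m := by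
  have hm0 : (m : ℝ) ≠ 0 := by positivity
  simp only [eval_fejerPoly_eq_sum]
  rw [intervalIntegral.integral_finsetSum fun i _ =>
    Continuous.intervalIntegrable (by fun_prop) _ _]
  have h (i : ℕ) (hi : i ∈ Finset.range m) : ∫ θ in (0 : ℝ)..Real.pi, ∑ j ∈ Finset.range m,
      ((m : ℝ) ^ 2)⁻¹ * Real.cos (((i : ℤ) - j : ℤ) * (2 * θ₀)) *
        Real.cos (((i : ℤ) - j : ℤ) * (2 * θ)) = ((m : ℝ) ^ 2)⁻¹ * Real.pi := by
    rw [intervalIntegral.integral_finsetSum fun j _ =>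
      Continuous.intervalIntegrable (by fun_prop) _ _]
    rw [Finset.sum_eq_single_of_mem i hi]
    · simp [mul_comm]
    · intro j _ hij
      have hk : (((i : ℤ) - j : ℤ) : ℝ) ≠ 0 := by
        rw [Int.cast_ne_zero]; omega
      rw [intervalIntegral.integral_const_mul]
      refine mul_eq_zero_of_right _ ?_
      have : ∀ θ : ℝ, (((i : ℤ) - j : ℤ) : ℝ) * (2 * θ) = ((((i : ℤ) - j : ℤ) : ℝ) * 2) * θ :=
        fun θ => by ring
      simp only [this]
      rw [intervalIntegral.integral_comp_mul_left (fun x => Real.cos x) (by positivity),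
        integral_cos, mul_assoc, ← mul_assoc _ 2, mul_comm _ (2 : ℝ), mul_assoc]
      have h2 := Real.sin_int_mul_pi (2 * ((i : ℤ) - j))
      push_cast at h2 ⊢
      rw [← mul_assoc, h2]
      simp
  rw [Finset.sum_congr rfl h, Finset.sum_const, Finset.card_range, nsmul_eq_mul]
  field_simp

theorem exists_sin_sq_eq {t : ℝ} (ht : t ∈ Icc (0 : ℝ) 1) :
    ∃ θ ∈ Icc 0 (Real.pi / 2), Real.sin θ ^ 2 = t ∧ Real.sin θ = √t := by
  have h1 : √t ≤ 1 := Real.sqrt_le_one.2 ht.2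
  have h0 := Real.sqrt_nonneg t
  have hs := Real.sin_arcsin (by linarith) h1
  exact ⟨Real.arcsin √t, ⟨Real.arcsin_nonneg.2 h0, Real.arcsin_le_pi_div_two _⟩,
    by rw [hs, Real.sq_sqrt ht.1], hs⟩

/-- A polynomial of degree at most a multiple of `δ ^ (-1/2)` which on `[0, 1]` is concentrated on
an interval of length comparable to `δ` at the endpoint `0`. -/
theorem exists_localizer {δ : ℝ} (hδ : 0 < δ) (hδ1 : δ ≤ 1) :
    ∃ g : Polynomial ℝ, (g.natDegree : ℝ) ≤ (3 * √δ)⁻¹ ∧ 1 / 2 ≤ g.eval δ ∧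
      ∀ y ∈ Icc (0 : ℝ) 1, 0 ≤ g.eval y ∧ g.eval y ≤ 1 ∧ g.eval y * √y ≤ 3 * √δ := by
  have hs : 0 < √δ := Real.sqrt_pos.2 hδ
  set k := ⌊(3 * √δ)⁻¹⌋₊ with hk
  have hkle : (k : ℝ) ≤ (3 * √δ)⁻¹ := Nat.floor_le (by positivity)
  have hklt : (3 * √δ)⁻¹ < k + 1 := Nat.lt_floor_add_one _
  have heval (θ : ℝ) : (fejerPoly (k + 1) 0).eval (Real.sin θ ^ 2) = fejer (k + 1) θ := by
    rw [eval_fejerPoly]; simp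
  refine ⟨fejerPoly (k + 1) 0, ?_, ?_, fun y hy => ?_⟩
  · refine le_trans ?_ hkle
    exact_mod_cast natDegree_fejerPoly_le (k + 1) 0
  · obtain ⟨θ, hθ, hθδ, hsin⟩ := exists_sin_sq_eq ⟨hδ.le, hδ1⟩
    rw [← hθδ, heval]
    refine half_le_fejer (by omega) ?_
    rw [abs_of_nonneg hθ.1]
    have h := Real.mul_le_sin hθ.1 hθ.2
    rw [hsin] at h
    have hθ' : θ ≤ Real.pi / 2 * √δ := by
      rw [div_mul_eq_mul_div, div_le_iff₀ Real.pi_pos] at h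
      linarith
    calc 2 * (((k + 1 : ℕ) : ℝ) - 1) * θ = 2 * k * θ := by push_cast; ring
      _ ≤ 2 * (3 * √δ)⁻¹ * (Real.pi / 2 * √δ) := by gcongr; exact hθ.1
      _ = Real.pi / 3 := by field_simp
  · obtain ⟨θ, -, hθy, hsin⟩ := exists_sin_sq_eq hy
    rw [← hθy, heval]
    refine ⟨fejer_nonneg _ _, fejer_le_one _ _, ?_⟩
    rw [Real.sqrt_sq_eq_abs]
    refine (fejer_mul_abs_sin_le _ _).trans (inv_le_of_inv_le₀ (by positivity) ?_)
    push_cast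
    exact hklt.le

/-- The upper bound for the Christoffel function of `[0, 1]`. -/
theorem exists_polynomial_integral_sq_le {N : ℕ} (hN : 1 ≤ N) {t : ℝ}
    (ht : ((N : ℝ) ^ 2)⁻¹ ≤ t) (ht1 : t ≤ 1) :
    ∃ q : Polynomial ℝ, q.natDegree ≤ 2 * N ∧ q.eval t = 1 ∧
      ∫ s in (0 : ℝ)..1, q.eval s ^ 2 ≤ 96 * Real.pi * √t / N := by
  have hN0 : (0 : ℝ) < N := by positivity
  have ht0 : 0 < t := lt_of_lt_of_le (by positivity) ht
  have hst : 0 < √t := Real.sqrt_pos.2 ht0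
  have hNt : 1 ≤ N * √t := by
    rw [← abs_of_pos hN0, ← Real.sqrt_sq_eq_abs, ← Real.sqrt_mul (by positivity)]
    rw [Real.one_le_sqrt]
    rwa [inv_le_iff_one_le_mul₀' (by positivity)] at ht
  obtain ⟨g, hgdeg, hgt, hg⟩ := exists_localizer ht0 ht1
  obtain ⟨θ₀, -, hθt, -⟩ := exists_sin_sq_eq ⟨ht0.le, ht1⟩
  set Q := fejerPoly N θ₀ with hQ
  have hQ01 (θ : ℝ) : 0 ≤ Q.eval (Real.sin θ ^ 2) ∧ Q.eval (Real.sin θ ^ 2) ≤ 1 := by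
    rw [eval_fejerPoly]
    constructor <;> linarith [fejer_nonneg N (θ - θ₀), fejer_nonneg N (θ + θ₀),
      fejer_le_one N (θ - θ₀), fejer_le_one N (θ + θ₀)]
  have hQt : 1 / 2 ≤ Q.eval t := by
    rw [← hθt, eval_fejerPoly, sub_self]
    have : 1 ≤ fejer N 0 := by simp [fejer]; field_simp; rfl
    linarith [fejer_nonneg N (θ₀ + θ₀)]
  set A := Q.eval t * g.eval t with hA
  have hA4 : 1 / 4 ≤ A := by nlinarith
  have hA0 : 0 < A := by linarith
  refine ⟨Polynomial.C A⁻¹ * (Q * g), ?_, ?_, ?_⟩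
  · refine (Polynomial.natDegree_C_mul_le _ _).trans (Polynomial.natDegree_mul_le.trans ?_)
    have h1 : Q.natDegree ≤ N - 1 := natDegree_fejerPoly_le N θ₀
    have h2 : (g.natDegree : ℝ) ≤ N := by
      refine hgdeg.trans ((inv_le_iff_one_le_mul₀' (by positivity)).2 ?_)
      linarith
    have h2 : g.natDegree ≤ N := by exact_mod_cast h2
    omega
  · rw [Polynomial.eval_mul, Polynomial.eval_C, Polynomial.eval_mul, inv_mul_cancel₀ hA0.ne']
  · set q := Polynomial.C A⁻¹ * (Q * g) with hq
    have hsub := intervalIntegral.integral_comp_mul_deriv (a := 0) (b := Real.pi / 2)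
      (f := fun θ => Real.sin θ ^ 2) (f' := fun θ => 2 * Real.sin θ * Real.cos θ)
      (g := fun s => q.eval s ^ 2)
      (fun θ _ => by simpa using (Real.hasDerivAt_sin θ).fun_pow 2)
      (Continuous.continuousOn (by fun_prop)) (q.continuous.pow 2)
    simp only [Function.comp_def, Real.sin_zero, Real.sin_pi_div_two, ne_eq, OfNat.ofNat_ne_zero,
      not_false_eq_true, zero_pow, one_pow] at hsub
    have hpi := Real.pi_pos
    rw [← hsub]
    have hcQ : Continuous fun θ : ℝ => Q.eval (Real.sin θ ^ 2) :=
      Q.continuous.comp (by fun_prop)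
    have hcq : Continuous fun θ : ℝ => q.eval (Real.sin θ ^ 2) :=
      q.continuous.comp (by fun_prop)
    calc ∫ θ in (0 : ℝ)..Real.pi / 2,
          q.eval (Real.sin θ ^ 2) ^ 2 * (2 * Real.sin θ * Real.cos θ)
        ≤ ∫ θ in (0 : ℝ)..Real.pi / 2, 96 * √t * Q.eval (Real.sin θ ^ 2) := by
          refine intervalIntegral.integral_mono_on (by positivity)
            (Continuous.intervalIntegrable (by fun_prop) _ _)
            (Continuous.intervalIntegrable (by fun_prop) _ _) fun θ hθ => ?_
          have hsin : 0 ≤ Real.sin θ := Real.sin_nonneg_of_nonneg_of_le_pi hθ.1 (by linarith [hθ.2])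
          have hcos : 0 ≤ Real.cos θ :=
            Real.cos_nonneg_of_neg_pi_div_two_le_of_le (by linarith [hθ.1]) hθ.2
          obtain ⟨hg0, hg1, hgs⟩ := hg (Real.sin θ ^ 2) ⟨by positivity, Real.sin_sq_le_one θ⟩
          rw [Real.sqrt_sq hsin] at hgs
          obtain ⟨hQ0, hQ1⟩ := hQ01 θ
          rw [hq, Polynomial.eval_mul, Polynomial.eval_C, Polynomial.eval_mul]
          set u := Q.eval (Real.sin θ ^ 2)
          set v := g.eval (Real.sin θ ^ 2)
          have hA' : A⁻¹ ≤ 4 := inv_le_of_inv_le₀ (by norm_num) (by linarith)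
          calc (A⁻¹ * (u * v)) ^ 2 * (2 * Real.sin θ * Real.cos θ)
              = 2 * A⁻¹ ^ 2 * (u * u) * v * (v * Real.sin θ) * Real.cos θ := by ring
            _ ≤ 2 * 4 ^ 2 * (u * 1) * 1 * (3 * √t) * 1 := by
              gcongr
              exact Real.cos_le_one θ
            _ = 96 * √t * u := by ring
      _ ≤ ∫ θ in (0 : ℝ)..Real.pi, 96 * √t * Q.eval (Real.sin θ ^ 2) := by
          refine intervalIntegral.integral_mono_interval le_rfl (by positivity) (by linarith)
            (Filter.Eventually.of_forall fun θ => ?_)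
            (Continuous.intervalIntegrable (by fun_prop) _ _)
          exact mul_nonneg (by positivity) (hQ01 θ).1
      _ = 96 * Real.pi * √t / N := by
          rw [intervalIntegral.integral_const_mul, integral_eval_fejerPoly hN]
          ring

/-- The trapezoid with vertices `(±a, 0)` and `(±1, 1)`, as a subset of `ℝ × ℝ`. -/
def trapezoid (a : ℝ) : Set (ℝ × ℝ) :=
  {z | 0 ≤ z.2 ∧ z.2 ≤ 1 ∧ |z.1| ≤ a + (1 - a) * z.2}

theorem isClosed_trapezoid (a : ℝ) : IsClosed (trapezoid a) :=
  (isClosed_le continuous_const continuous_snd).inter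
    ((isClosed_le continuous_snd continuous_const).inter
      (isClosed_le (f := fun z : ℝ × ℝ => |z.1|) (g := fun z : ℝ × ℝ => a + (1 - a) * z.2)
        (by fun_prop) (by fun_prop)))

theorem isCompact_trapezoid {a : ℝ} (ha1 : a ≤ 1) : IsCompact (trapezoid a) := by
  refine (isCompact_Icc.prod isCompact_Icc).of_isClosed_subset (isClosed_trapezoid a)
    (?_ : _ ⊆ Icc (-1 : ℝ) 1 ×ˢ Icc (0 : ℝ) 1)
  rintro ⟨x, y⟩ ⟨h0, h1, hx⟩
  have : |x| ≤ 1 := hx.trans (by nlinarith)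
  exact ⟨abs_le.1 this, h0, h1⟩

theorem convexHull_eq_preimage_trapezoid {a : ℝ} (ha : 0 < a) :
    convexHull ℝ {e2 (-a) 0, e2 a 0, e2 (-1) 1, e2 1 1} =
      (fun y : E2 => (y 0, y 1)) ⁻¹' trapezoid a := by
  apply Subset.antisymm
  · refine convexHull_min ?_ ?_
    · rintro y (rfl | rfl | rfl | rfl) <;>
        simp [trapezoid, e2, abs_of_pos ha]
    · intro y ⟨hy0, hy1, hy⟩ z ⟨hz0, hz1, hz⟩ s t hs ht hst
      simp only [abs_le] at hy hz hy0 hz0 hy1 hz1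
      simp only [trapezoid, mem_preimage, mem_ofPred_eq, PiLp.add_apply, PiLp.smul_apply,
        smul_eq_mul, abs_le]
      obtain rfl : t = 1 - s := by linarith
      refine ⟨by positivity, by nlinarith, ?_, ?_⟩ <;> nlinarith
  · rintro y ⟨hy0, hy1, hy⟩
    simp only [abs_le] at hy hy0 hy1
    set w := a + (1 - a) * y 1 with hw
    have hw0 : 0 < w := by
      rcases hy0.eq_or_lt with h | h
      · rw [hw, ← h]; linarith
      · nlinarith
    set l := (1 + y 0 / w) / 2 with hl
    have hlw : (2 * l - 1) * w = y 0 := by rw [hl]; field_simp; ring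
    have hl0 : 0 ≤ l := by nlinarith
    have hl1 : l ≤ 1 := by nlinarith
    have hconv := convex_convexHull ℝ ({e2 (-a) 0, e2 a 0, e2 (-1) 1, e2 1 1} : Set E2)
    have hmem {v : E2} (hv : v ∈ ({e2 (-a) 0, e2 a 0, e2 (-1) 1, e2 1 1} : Set E2)) :=
      subset_convexHull ℝ _ hv
    have hA := hconv (hmem (v := e2 (-a) 0) (by simp)) (hmem (v := e2 a 0) (by simp))
      (sub_nonneg.2 hl1) hl0 (by ring)
    have hB := hconv (hmem (v := e2 (-1) 1) (by simp)) (hmem (v := e2 1 1) (by simp))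
      (sub_nonneg.2 hl1) hl0 (by ring)
    convert hconv hA hB (sub_nonneg.2 hy1) hy0 (by ring) using 1
    ext i
    fin_cases i
    · simp [e2]
      linear_combination -hlw
    · simp [e2]
      ring

theorem setIntegral_euclidean_eq (S : Set (ℝ × ℝ)) (F : ℝ × ℝ → ℝ) :
    ∫ y in (fun y : E2 => (y 0, y 1)) ⁻¹' S, F (y 0, y 1) = ∫ z in S, F z := by
  have h : MeasurePreserving (fun y : E2 => (y 0, y 1)) volume volume :=
    (volume_preserving_finTwoArrow ℝ).comp
      (EuclideanSpace.volume_preserving_symm_measurableEquiv_toLp (Fin 2))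
  exact h.setIntegral_preimage_emb
    (((MeasurableEquiv.toLp 2 (Fin 2 → ℝ)).symm.trans
      MeasurableEquiv.finTwoArrow).measurableEmbedding) F S

/-- The integral over an elliptic region, in coordinates `(α, β)` for which the horizontal and
vertical sections are images of circles. -/
theorem setIntegral_ellipse_le {b h c : ℝ} (hb : 0 < b) (hh : 0 < h) {I J : Set ℝ}
    (hI : MeasurableSet I) (hJ : MeasurableSet J) (hIinj : InjOn Real.cos I)
    (hJinj : InjOn Real.cos J) (hIsin : ∀ x ∈ I, Real.sin x ≠ 0)
    {S : Set (ℝ × ℝ)} (hS : IsCompact S)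
    (hsub : ∀ α β : ℝ, (b * Real.cos α, c - h * Real.sin α * Real.cos β) ∈ S)
    {G : ℝ × ℝ → ℝ} (hG : Continuous G) (hG0 : ∀ z, 0 ≤ G z) :
    ∫ z in I ×ˢ J, b * h * (Real.sin z.1 ^ 2 * |Real.sin z.2|) *
        G (b * Real.cos z.1, c - h * Real.sin z.1 * Real.cos z.2) ≤ ∫ z in S, G z := by
  set Φ : ℝ × ℝ → ℝ × ℝ :=
    fun z => (b * Real.cos z.1, c - h * Real.sin z.1 * Real.cos z.2) with hΦ
  set Φ' : ℝ × ℝ → ℝ × ℝ →L[ℝ] ℝ × ℝ := fun z =>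
    (Matrix.toLin (.finTwoProd ℝ) (.finTwoProd ℝ)
      !![-(b * Real.sin z.1), 0; -(h * Real.cos z.1 * Real.cos z.2),
        h * Real.sin z.1 * Real.sin z.2]).toContinuousLinearMap with hΦ'
  have hderiv (z : ℝ × ℝ) : HasFDerivAt Φ (Φ' z) z := by
    simp only [hΦ', Matrix.toLin_finTwoProd_toContinuousLinearMap]
    have h1 := (Real.hasDerivAt_cos z.1).comp_hasFDerivAt z (hasFDerivAt_fst (𝕜 := ℝ))
    have h2 := (Real.hasDerivAt_sin z.1).comp_hasFDerivAt z (hasFDerivAt_fst (𝕜 := ℝ))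
    have h3 := (Real.hasDerivAt_cos z.2).comp_hasFDerivAt z (hasFDerivAt_snd (𝕜 := ℝ))
    refine HasFDerivAt.congr_fderiv
      ((h1.const_mul b).prodMk (((h2.const_mul h).mul h3).const_sub c)) ?_
    ext <;> simp
    ring
  have hdet (z : ℝ × ℝ) : |(Φ' z).det| = b * h * (Real.sin z.1 ^ 2 * |Real.sin z.2|) := by
    simp only [hΦ', LinearMap.det_toContinuousLinearMap, LinearMap.det_toLin,
      Matrix.det_fin_two_of]
    rw [show -(b * Real.sin z.1) * (h * Real.sin z.1 * Real.sin z.2) -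
      0 * -(h * Real.cos z.1 * Real.cos z.2) =
      -(b * h * (Real.sin z.1 ^ 2 * Real.sin z.2)) by ring, abs_neg, abs_mul,
      abs_of_pos (mul_pos hb hh), abs_mul, abs_of_nonneg (sq_nonneg (Real.sin z.1))]
  have hinj : InjOn Φ (I ×ˢ J) := by
    rintro ⟨x, y⟩ ⟨hx, hy⟩ ⟨x', y'⟩ ⟨hx', hy'⟩ heq
    simp only [hΦ, Prod.mk.injEq] at heq hx hy hx' hy'
    obtain rfl := hIinj hx hx' (mul_left_cancel₀ hb.ne' heq.1)
    have := hJinj hy hy' (mul_left_cancel₀ (mul_ne_zero hh.ne' (hIsin x hx))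
      (sub_right_injective heq.2))
    rw [this]
  have hcv := integral_image_eq_integral_abs_det_fderiv_smul volume (hI.prod hJ)
    (fun z _ => (hderiv z).hasFDerivWithinAt) hinj G
  simp only [hdet, smul_eq_mul] at hcv
  rw [← hcv]
  refine setIntegral_mono_set (hG.continuousOn.integrableOn_compact hS)
    (Filter.Eventually.of_forall hG0) (LE.le.eventuallyLE ?_)
  rintro _ ⟨z, -, rfl⟩
  exact hsub _ _

/-- The integral over the trapezoid, in coordinates `(u, y)` adapted to its left and bottom
sides. -/
theorem setIntegral_trapezoid_le {a : ℝ} (ha1 : a ≤ 1) {G : ℝ × ℝ → ℝ}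
    (hG : Continuous G) (hG0 : ∀ z, 0 ≤ G z) :
    ∫ z in trapezoid a, G z ≤
      ∫ z in Icc (0 : ℝ) 1 ×ˢ Icc (0 : ℝ) 1, 2 * G (2 * z.1 - a - (1 - a) * z.2, z.2) := by
  set Φ : ℝ × ℝ → ℝ × ℝ := fun z => (2 * z.1 - a - (1 - a) * z.2, z.2) with hΦ
  set Φ' : ℝ × ℝ →L[ℝ] ℝ × ℝ :=
    (Matrix.toLin (.finTwoProd ℝ) (.finTwoProd ℝ)
      !![2, -(1 - a); 0, 1]).toContinuousLinearMap with hΦ'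
  have hderiv (z : ℝ × ℝ) : HasFDerivAt Φ Φ' z := by
    simp only [hΦ', Matrix.toLin_finTwoProd_toContinuousLinearMap]
    refine HasFDerivAt.congr_fderiv
      (((((hasFDerivAt_fst (𝕜 := ℝ) (p := z)).const_mul 2).sub_const a).sub
        (hasFDerivAt_snd.const_mul (1 - a))).prodMk hasFDerivAt_snd) ?_
    ext <;> simp
  have hdet : |Φ'.det| = 2 := by
    simp [hΦ', LinearMap.det_toContinuousLinearMap, LinearMap.det_toLin, Matrix.det_fin_two_of]
  have hinj : InjOn Φ (Icc (0 : ℝ) 1 ×ˢ Icc (0 : ℝ) 1) := by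
    rintro ⟨x, y⟩ - ⟨x', y'⟩ - heq
    simp only [hΦ, Prod.mk.injEq] at heq ⊢
    obtain ⟨h1, rfl⟩ := heq
    exact ⟨by linarith, rfl⟩
  have hcv := integral_image_eq_integral_abs_det_fderiv_smul volume
    (measurableSet_Icc.prod measurableSet_Icc)
    (fun z _ => (hderiv z).hasFDerivWithinAt) hinj G
  simp only [hdet, smul_eq_mul] at hcv
  rw [← hcv]
  have hcomp : IsCompact (Φ '' (Icc (0 : ℝ) 1 ×ˢ Icc (0 : ℝ) 1)) :=
    (isCompact_Icc.prod isCompact_Icc).image (by fun_prop)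
  refine setIntegral_mono_set (hG.continuousOn.integrableOn_compact hcomp)
    (Filter.Eventually.of_forall hG0) (LE.le.eventuallyLE ?_)
  rintro ⟨x, y⟩ ⟨h0, h1, hx⟩
  simp only [abs_le] at h0 h1 hx
  refine ⟨((x + a + (1 - a) * y) / 2, y), ⟨⟨?_, ?_⟩, h0, h1⟩, ?_⟩
  · simp only; linarith
  · simp only; nlinarith
  · simp only [hΦ, Prod.mk.injEq, and_true]
    ring

theorem injOn_cos_Ioo_zero_pi : InjOn Real.cos (Ioo 0 Real.pi) :=
  Real.injOn_cos.mono Ioo_subset_Icc_self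

theorem injOn_cos_Ioo_neg_pi_zero : InjOn Real.cos (Ioo (-Real.pi) 0) := by
  intro x hx y hy h
  rw [← Real.cos_neg x, ← Real.cos_neg y] at h
  exact neg_injective (injOn_cos_Ioo_zero_pi ⟨by linarith [hx.2], by linarith [hx.1]⟩
    ⟨by linarith [hy.2], by linarith [hy.1]⟩ h)

theorem integral_integral_ellipse_le {b h c : ℝ} (hb : 0 < b) (hh : 0 < h)
    {S : Set (ℝ × ℝ)} (hS : IsCompact S)
    (hsub : ∀ α β : ℝ, (b * Real.cos α, c - h * Real.sin α * Real.cos β) ∈ S)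
    {G : ℝ × ℝ → ℝ} (hG : Continuous G) (hG0 : ∀ z, 0 ≤ G z) :
    ∫ α in (-Real.pi)..Real.pi, ∫ β in (-Real.pi)..Real.pi,
        b * h * (Real.sin α ^ 2 * |Real.sin β|) *
          G (b * Real.cos α, c - h * Real.sin α * Real.cos β) ≤ 4 * ∫ z in S, G z := by
  set F : ℝ → ℝ → ℝ := fun α β => b * h * (Real.sin α ^ 2 * |Real.sin β|) *
    G (b * Real.cos α, c - h * Real.sin α * Real.cos β) with hF
  have hFc : Continuous (Function.uncurry F) := by
    simp only [hF, Function.uncurry_def]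
    fun_prop
  have hFα (α : ℝ) : Continuous (F α) := by
    simp only [hF]
    fun_prop
  have hFint (l r : ℝ) : Continuous fun α => ∫ β in l..r, F α β :=
    intervalIntegral.continuous_parametric_intervalIntegral_of_continuous' hFc l r
  have piece {l r l' r' : ℝ} (hlr : l ≤ r) (hlr' : l' ≤ r')
      (hI : InjOn Real.cos (Ioo l r)) (hJ : InjOn Real.cos (Ioo l' r'))
      (hs : ∀ x ∈ Ioo l r, Real.sin x ≠ 0) :
      ∫ α in l..r, ∫ β in l'..r', F α β ≤ ∫ z in S, G z := by
    refine le_trans (le_of_eq ?_) (setIntegral_ellipse_le hb hh measurableSet_Ioo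
      measurableSet_Ioo hI hJ hs hS hsub hG hG0)
    simp only [intervalIntegral.integral_of_le hlr, intervalIntegral.integral_of_le hlr',
      integral_Ioc_eq_integral_Ioo]
    refine (setIntegral_prod (Function.uncurry F) ?_).symm
    exact (hFc.continuousOn.integrableOn_compact (isCompact_Icc.prod isCompact_Icc)).mono_set
      (prod_mono Ioo_subset_Icc_self Ioo_subset_Icc_self)
  have hpi := Real.pi_pos
  have hs1 : ∀ x ∈ Ioo 0 Real.pi, Real.sin x ≠ 0 := fun x hx =>
    (Real.sin_pos_of_pos_of_lt_pi hx.1 hx.2).ne'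
  have hs2 : ∀ x ∈ Ioo (-Real.pi) 0, Real.sin x ≠ 0 := fun x hx =>
    (Real.sin_neg_of_neg_of_neg_pi_lt hx.2 hx.1).ne
  have hsplit (α : ℝ) : ∫ β in (-Real.pi)..Real.pi, F α β =
      (∫ β in (-Real.pi)..0, F α β) + ∫ β in (0 : ℝ)..Real.pi, F α β :=
    (intervalIntegral.integral_add_adjacent_intervals ((hFα α).intervalIntegrable _ _)
      ((hFα α).intervalIntegrable _ _)).symm
  change ∫ α in (-Real.pi)..Real.pi, ∫ β in (-Real.pi)..Real.pi, F α β ≤ _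
  simp only [hsplit]
  rw [intervalIntegral.integral_add ((hFint _ _).intervalIntegrable _ _)
    ((hFint _ _).intervalIntegrable _ _),
    ← intervalIntegral.integral_add_adjacent_intervals (b := 0)
      ((hFint (-Real.pi) 0).intervalIntegrable _ _) ((hFint _ _).intervalIntegrable _ _),
    ← intervalIntegral.integral_add_adjacent_intervals (b := 0)
      ((hFint 0 Real.pi).intervalIntegrable _ _) ((hFint _ _).intervalIntegrable _ _)]
  have h1 := piece (by linarith) (by linarith) injOn_cos_Ioo_neg_pi_zero
    injOn_cos_Ioo_neg_pi_zero hs2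
  have h2 := piece (by linarith) (by linarith) injOn_cos_Ioo_zero_pi
    injOn_cos_Ioo_neg_pi_zero hs1
  have h3 := piece (by linarith) (by linarith) injOn_cos_Ioo_neg_pi_zero
    injOn_cos_Ioo_zero_pi hs2
  have h4 := piece (by linarith) (by linarith) injOn_cos_Ioo_zero_pi
    injOn_cos_Ioo_zero_pi hs1
  linarith

theorem ellipse_subset_trapezoid {a δ : ℝ} (ha : 0 < a) (ha1 : a ≤ 1 / 3) (hδ : 0 < δ)
    (hδ1 : δ ≤ 1 / 2) (α β : ℝ) :
    (√(a + δ) / 3 * Real.cos α,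
      (1 / 2 + δ / 4) - (1 / 2 - δ / 4) * Real.sin α * Real.cos β) ∈ trapezoid a := by
  set v := Real.sin α * Real.cos β with hv
  have hv2 : v ^ 2 ≤ Real.sin α ^ 2 := by
    rw [hv, mul_pow]
    exact mul_le_of_le_one_right (sq_nonneg _) (Real.cos_sq_le_one β)
  have hv1 : -1 ≤ v ∧ v ≤ 1 := abs_le.1 (by
    rw [← sq_le_one_iff_abs_le_one]
    exact hv2.trans (Real.sin_sq_le_one α))
  set y := (1 / 2 + δ / 4) - (1 / 2 - δ / 4) * v with hy
  rw [mul_assoc, ← hv]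
  have hy0 : δ / 2 ≤ y := by nlinarith
  refine ⟨by linarith, by nlinarith, abs_le_of_sq_le_sq ?_ (by nlinarith)⟩
  rw [mul_pow, div_pow, Real.sq_sqrt (by linarith)]
  have hcos : Real.cos α ^ 2 ≤ 16 / 3 * (y - δ / 2) := by
    have h1 : Real.cos α ^ 2 ≤ 2 * (1 - v) := by
      nlinarith [Real.sin_sq_add_cos_sq α]
    have h2 : 3 / 8 * (1 - v) ≤ y - δ / 2 := by nlinarith
    linarith
  have hlin : 2 / 3 * (a + y) ≤ a + (1 - a) * y := by nlinarith
  calc (a + δ) / 3 ^ 2 * Real.cos α ^ 2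
      ≤ (a + δ) / 3 ^ 2 * (16 / 3 * (y - δ / 2)) := by gcongr
    _ ≤ (2 / 3 * (a + y)) ^ 2 := by
      nlinarith [sq_nonneg (a + δ / 2 - (y - δ / 2)), mul_nonneg ha.le (sub_nonneg.2 hy0)]
    _ ≤ _ := by
      have h0 : 0 ≤ 2 / 3 * (a + y) := by linarith
      gcongr

theorem integral_integral_mono {F G : ℝ → ℝ → ℝ} (hF : Continuous (Function.uncurry F))
    (hG : Continuous (Function.uncurry G)) (h : ∀ α β, F α β ≤ G α β) {u v : ℝ} (huv : u ≤ v) :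
    ∫ α in u..v, ∫ β in u..v, F α β ≤ ∫ α in u..v, ∫ β in u..v, G α β := by
  refine intervalIntegral.integral_mono_on huv
    ((intervalIntegral.continuous_parametric_intervalIntegral_of_continuous' hF
      u v).intervalIntegrable _ _)
    ((intervalIntegral.continuous_parametric_intervalIntegral_of_continuous' hG
      u v).intervalIntegrable _ _) fun α _ => ?_
  exact intervalIntegral.integral_mono_on huv ((hF.uncurry_left α).intervalIntegrable _ _)
    ((hG.uncurry_left α).intervalIntegrable _ _) fun β _ => h α β

theorem IsTrigPoly.sq_le_integral_integral {n : ℕ} (hn : 1 ≤ n) {f : ℝ → ℝ → ℝ}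
    (hfβ : ∀ α, IsTrigPoly (2 * n + 1) (f α)) (hfα : ∀ β, IsTrigPoly (2 * n + 1) fun α => f α β)
    (hfc : Continuous (Function.uncurry fun α β => f α β ^ 2)) (α₀ β₀ : ℝ) :
    f α₀ β₀ ^ 2 ≤
      4 * n ^ 2 * ∫ α in (-Real.pi)..Real.pi, ∫ β in (-Real.pi)..Real.pi, f α β ^ 2 := by
  have hpi := Real.pi_pos
  have hM : (2 * ((2 * n + 1 : ℕ) : ℝ) + 1) * (2 * Real.pi)⁻¹ ≤ 2 * n := by
    rw [← div_eq_mul_inv, div_le_iff₀ (by positivity)]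
    have h1 : (1 : ℝ) ≤ n := by exact_mod_cast hn
    push_cast
    nlinarith [Real.pi_gt_three]
  have hstep {F : ℝ → ℝ} (hF : IsTrigPoly (2 * n + 1) F) (θ : ℝ) :
      F θ ^ 2 ≤ 2 * n * ∫ t in (-Real.pi)..Real.pi, F t ^ 2 := by
    refine (hF.sq_le_integral θ).trans ?_
    rw [← mul_assoc]
    exact mul_le_mul_of_nonneg_right hM
      (intervalIntegral.integral_nonneg (by linarith) fun t _ => sq_nonneg _)
  have hswap : ∫ α in (-Real.pi)..Real.pi, ∫ β in (-Real.pi)..Real.pi, f α β ^ 2 =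
      ∫ β in (-Real.pi)..Real.pi, ∫ α in (-Real.pi)..Real.pi, f α β ^ 2 :=
    intervalIntegral_intervalIntegral_swap (F := fun α β => f α β ^ 2) <|
      (hfc.continuousOn.integrableOn_compact
        (isCompact_uIcc.prod isCompact_uIcc)).mono_set
        (prod_mono uIoc_subset_uIcc uIoc_subset_uIcc)
  have hfc' : Continuous (Function.uncurry fun β α => f α β ^ 2) := hfc.comp continuous_swap
  calc f α₀ β₀ ^ 2
      ≤ 2 * n * ∫ β in (-Real.pi)..Real.pi, f α₀ β ^ 2 := hstep (hfβ _) β₀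
    _ ≤ 2 * n * ∫ β in (-Real.pi)..Real.pi,
          2 * n * ∫ α in (-Real.pi)..Real.pi, f α β ^ 2 := by
        refine mul_le_mul_of_nonneg_left ?_ (by positivity)
        exact intervalIntegral.integral_mono_on (by linarith)
          ((hfc.uncurry_left α₀).intervalIntegrable _ _)
          (((intervalIntegral.continuous_parametric_intervalIntegral_of_continuous' hfc'
            _ _).const_mul (2 * n : ℝ)).intervalIntegrable _ _)
          fun β _ => hstep (hfα β) _
    _ = _ := by
        rw [intervalIntegral.integral_const_mul, hswap]
        ring

theorem abs_sin_le_sqrt {δ : ℝ} (hδ : 0 ≤ δ) (hδ1 : δ ≤ 1 / 2) (α β : ℝ) :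
    |Real.sin β| ≤
      3 * √((1 / 2 + δ / 4) - (1 / 2 - δ / 4) * Real.sin α * Real.cos β) := by
  have hv2 : (Real.sin α * Real.cos β) ^ 2 ≤ Real.cos β ^ 2 := by
    rw [mul_pow]
    exact mul_le_of_le_one_left (sq_nonneg _) (Real.sin_sq_le_one α)
  rw [mul_assoc]
  set v := Real.sin α * Real.cos β with hv
  have hv1 : v ≤ 1 := (abs_le.1 ((sq_le_one_iff_abs_le_one _).1
    (hv2.trans (Real.cos_sq_le_one β)))).2
  refine abs_le_of_sq_le_sq ?_ (by positivity)
  rw [mul_pow, Real.sq_sqrt (by nlinarith)]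
  nlinarith [Real.sin_sq_add_cos_sq β]

theorem sq_eval_le_setIntegral_trapezoid {a δ : ℝ} (ha : 0 < a) (ha1 : a ≤ 1 / 3) {n : ℕ}
    (hδ : ((n : ℝ) ^ 2)⁻¹ ≤ δ) (hn : 1 ≤ n) (hδ1 : δ ≤ 1 / 2) {p : MvPolynomial (Fin 2) ℝ}
    (hp : p.totalDegree ≤ n) :
    MvPolynomial.eval ![0, δ] p ^ 2 * (√δ * √(a + δ)) ≤
      4608 * n ^ 2 * ∫ z in trapezoid a, MvPolynomial.eval ![z.1, z.2] p ^ 2 := by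
  have hn0 : (0 : ℝ) < n := by positivity
  have hδ0 : 0 < δ := lt_of_lt_of_le (by positivity) hδ
  have hs : 0 < √δ := Real.sqrt_pos.2 hδ0
  have hw : 0 < √(a + δ) := Real.sqrt_pos.2 (by linarith)
  have hss : √δ * √δ = δ := Real.mul_self_sqrt hδ0.le
  have hns : 1 ≤ n * √δ := by
    rw [← abs_of_pos hn0, ← Real.sqrt_sq_eq_abs, ← Real.sqrt_mul (by positivity), Real.one_le_sqrt]
    rwa [inv_le_iff_one_le_mul₀' (by positivity)] at hδ
  obtain ⟨g, hgdeg, hgδ, hg⟩ := exists_localizer hδ0 (by linarith)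
  have hgn : g.natDegree ≤ n := by
    have : (g.natDegree : ℝ) ≤ n := by
      refine hgdeg.trans ((inv_le_iff_one_le_mul₀' (by positivity)).2 ?_)
      linarith
    exact_mod_cast this
  set b := √(a + δ) / 3 with hb
  set h := 1 / 2 - δ / 4 with hh
  set c := 1 / 2 + δ / 4 with hc
  have hb0 : 0 < b := by positivity
  have hh0 : 3 / 8 ≤ h := by linarith
  have hsub := ellipse_subset_trapezoid ha ha1 hδ0 hδ1
  rw [← hb, ← hh, ← hc] at hsub
  set G : ℝ × ℝ → ℝ := fun z => MvPolynomial.eval ![z.1, z.2] p ^ 2 with hG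
  have hGc : Continuous G :=
    ((MvPolynomial.continuous_eval p).comp (by fun_prop)).pow 2
  have hellipse := integral_integral_ellipse_le hb0 (by linarith : 0 < h)
    (isCompact_trapezoid (by linarith : a ≤ 1)) hsub hGc (fun z => sq_nonneg _)
  set D := ∫ z in trapezoid a, G z with hD
  set Y : ℝ → ℝ → ℝ := fun α β => c - h * Real.sin α * Real.cos β with hY
  set f : ℝ → ℝ → ℝ := fun α β => MvPolynomial.eval ![b * Real.cos α, Y α β] p *
    g.eval (Y α β) * (Real.sin α * Real.sin β) with hf
  have hconst (r : ℝ) : IsTrigPoly 1 fun _ => r := (IsTrigPoly.const r).mono zero_le_one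
  have hfβ (α : ℝ) : IsTrigPoly (2 * n + 1) (f α) := by
    have hy : IsTrigPoly 1 (Y α) := by
      simpa [hY, sub_eq_add_neg] using
        (hconst c).add (IsTrigPoly.cos.const_mul (-(h * Real.sin α)))
    exact (((IsTrigPoly.mvPolynomial_eval hp (hconst _) hy).mul
      (IsTrigPoly.polynomial_eval hgn hy)).mul (IsTrigPoly.sin.const_mul _)).mono (by omega)
  have hfα (β : ℝ) : IsTrigPoly (2 * n + 1) fun α => f α β := by
    have hy : IsTrigPoly 1 fun α => Y α β := by
      have := (hconst c).add (IsTrigPoly.sin.const_mul (-(h * Real.cos β)))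
      convert this using 2
      simp only [hY]
      ring
    have hsin : IsTrigPoly 1 fun α => Real.sin α * Real.sin β := by
      simpa [mul_comm] using IsTrigPoly.sin.const_mul (Real.sin β)
    exact (((IsTrigPoly.mvPolynomial_eval hp (IsTrigPoly.cos.const_mul b) hy).mul
      (IsTrigPoly.polynomial_eval hgn hy)).mul hsin).mono (by omega)
  have hYc : Continuous (Function.uncurry Y) := by
    simp only [hY, Function.uncurry_def]
    fun_prop
  have hfc : Continuous (Function.uncurry fun α β => f α β ^ 2) := by
    have h1 : Continuous fun z : ℝ × ℝ =>
        MvPolynomial.eval ![b * Real.cos z.1, Function.uncurry Y z] p :=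
      (MvPolynomial.continuous_eval p).comp (by fun_prop)
    have h2 : Continuous fun z : ℝ × ℝ => g.eval (Function.uncurry Y z) :=
      g.continuous.comp hYc
    exact ((h1.mul h2).mul (by fun_prop)).pow 2
  have hpi := Real.pi_pos
  have hpt (α β : ℝ) : b * h * f α β ^ 2 ≤ 9 * √δ *
      (b * h * (Real.sin α ^ 2 * |Real.sin β|) * G (b * Real.cos α, Y α β)) := by
    have hy0 : 0 ≤ Y α β := (hsub α β).1
    have hy1 : Y α β ≤ 1 := (hsub α β).2.1
    obtain ⟨hg0, hg1, hgs⟩ := hg (Y α β) ⟨hy0, hy1⟩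
    have hsinβ : |Real.sin β| ≤ 3 * √(Y α β) := abs_sin_le_sqrt hδ0.le hδ1 α β
    have hle : g.eval (Y α β) ^ 2 * |Real.sin β| ≤ 9 * √δ := by
      calc g.eval (Y α β) ^ 2 * |Real.sin β| ≤
          g.eval (Y α β) ^ 2 * (3 * √(Y α β)) := by gcongr
        _ = 3 * g.eval (Y α β) * (g.eval (Y α β) * √(Y α β)) := by ring
        _ ≤ 3 * 1 * (3 * √δ) := by gcongr
        _ = 9 * √δ := by ring
    have heq : b * h * f α β ^ 2 = (g.eval (Y α β) ^ 2 * |Real.sin β|) *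
        (b * h * (Real.sin α ^ 2 * |Real.sin β|) * G (b * Real.cos α, Y α β)) := by
      have : Real.sin β ^ 2 = |Real.sin β| * |Real.sin β| := by rw [← sq, sq_abs]
      simp only [hf, hG]
      rw [mul_pow, mul_pow, mul_pow, this]
      ring
    rw [heq]
    refine mul_le_mul_of_nonneg_right hle ?_
    simp only [hG]
    positivity
  have hJc : Continuous (Function.uncurry fun α β =>
      b * h * (Real.sin α ^ 2 * |Real.sin β|) * G (b * Real.cos α, Y α β)) := by
    simp only [Function.uncurry_def]
    exact Continuous.mul (by fun_prop) (hGc.comp (by fun_prop))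
  have hint : b * h * ∫ α in (-Real.pi)..Real.pi, ∫ β in (-Real.pi)..Real.pi, f α β ^ 2 ≤
      9 * √δ * (4 * D) := by
    refine le_trans ?_ (mul_le_mul_of_nonneg_left hellipse (by positivity))
    simp only [← intervalIntegral.integral_const_mul]
    exact integral_integral_mono (F := fun α β => b * h * f α β ^ 2)
      (G := fun α β => 9 * √δ *
        (b * h * (Real.sin α ^ 2 * |Real.sin β|) * G (b * Real.cos α, Y α β)))
      (hfc.const_mul (b * h)) (hJc.const_mul (9 * √δ)) hpt (by linarith)
  have hnik (β : ℝ) := IsTrigPoly.sq_le_integral_integral hn hfβ hfα hfc (Real.pi / 2) β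
  have hh0' : 0 < h := by linarith
  obtain ⟨β₀, hβ₀⟩ : ∃ β₀, Real.cos β₀ = (c - δ) / h :=
    ⟨Real.arccos ((c - δ) / h), Real.cos_arccos
      (by rw [le_div_iff₀ hh0']; linarith) (by rw [div_le_iff₀ hh0']; linarith)⟩
  have hY₀ : Y (Real.pi / 2) β₀ = δ := by
    simp only [hY, Real.sin_pi_div_two, hβ₀]
    field_simp
    ring
  have hsin₀ : δ ≤ Real.sin β₀ ^ 2 := by
    rw [Real.sin_sq, hβ₀, div_pow, le_sub_iff_add_le, ← le_sub_iff_add_le',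
      div_le_iff₀ (by positivity), hc, hh]
    have : 0 ≤ δ * (1 / 4 - δ / 4 - δ ^ 2 / 16) := mul_nonneg hδ0.le (by nlinarith)
    linarith
  have hf₀ : MvPolynomial.eval ![0, δ] p ^ 2 * (δ / 4) ≤ f (Real.pi / 2) β₀ ^ 2 := by
    simp only [hf, hY₀, Real.cos_pi_div_two, mul_zero, Real.sin_pi_div_two, one_mul]
    rw [mul_pow, mul_pow, mul_assoc]
    have hg2 : 1 / 4 ≤ g.eval δ ^ 2 := by nlinarith
    have := mul_le_mul hg2 hsin₀ hδ0.le (sq_nonneg _)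
    gcongr
    linarith
  have hmain := hf₀.trans (hnik β₀)
  set I := ∫ α in (-Real.pi)..Real.pi, ∫ β in (-Real.pi)..Real.pi, f α β ^ 2 with hI
  have hI0 : 0 ≤ I := intervalIntegral.integral_nonneg (by linarith) fun α _ =>
    intervalIntegral.integral_nonneg (by linarith) fun β _ => sq_nonneg _
  have hbh : √(a + δ) / 8 ≤ b * h := by
    rw [hb]; nlinarith
  have hI1 : √(a + δ) * I ≤ 288 * √δ * D := by
    have := mul_le_mul_of_nonneg_right hbh hI0
    linarith
  set e := MvPolynomial.eval ![0, δ] p ^ 2 with he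
  refine le_of_mul_le_mul_right ?_ hs
  calc e * (√δ * √(a + δ)) * √δ = e * (√δ * √δ) * √(a + δ) := by ring
    _ = 4 * (e * (δ / 4)) * √(a + δ) := by rw [hss]; ring
    _ ≤ 4 * (4 * n ^ 2 * I) * √(a + δ) := by gcongr
    _ = 16 * n ^ 2 * (√(a + δ) * I) := by ring
    _ ≤ 16 * n ^ 2 * (288 * √δ * D) := by gcongr
    _ = 4608 * n ^ 2 * D * √δ := by ring

theorem totalDegree_aeval_le (q : Polynomial ℝ) {r : MvPolynomial (Fin 2) ℝ}
    (hr : r.totalDegree ≤ 1) : (Polynomial.aeval r q).totalDegree ≤ q.natDegree := by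
  rw [Polynomial.aeval_eq_sum_range]
  refine MvPolynomial.totalDegree_finsetSum_le fun i hi => ?_
  refine (MvPolynomial.totalDegree_smul_le _ _).trans ((MvPolynomial.totalDegree_pow _ _).trans ?_)
  rw [Finset.mem_range] at hi
  exact (Nat.mul_le_mul_left i hr).trans (by omega)

theorem exists_mvPolynomial_setIntegral_trapezoid_le {a δ : ℝ} (ha : 0 < a) (ha1 : a ≤ 1 / 3)
    {n : ℕ} (hδ : 128 * ((n : ℝ) ^ 2)⁻¹ ≤ δ) (hn : 1 ≤ n) (hδ1 : δ ≤ 1 / 2) :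
    ∃ p : MvPolynomial (Fin 2) ℝ, p.totalDegree ≤ n ∧ MvPolynomial.eval ![0, δ] p = 1 ∧
      ∫ z in trapezoid a, MvPolynomial.eval ![z.1, z.2] p ^ 2 ≤
        20000000 * ((n : ℝ) ^ 2)⁻¹ * (√δ * √(a + δ)) := by
  have hn0 : (0 : ℝ) < n := by positivity
  have hn2 : 128 ≤ δ * (n : ℝ) ^ 2 := by
    rwa [← div_eq_mul_inv, div_le_iff₀ (by positivity)] at hδ
  have hδ0 : 0 < δ := lt_of_lt_of_le (by positivity) hδ
  have hn16 : 16 ≤ n := by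
    have : (16 : ℝ) ≤ n := by nlinarith
    exact_mod_cast this
  set N := n / 4 with hN
  have hN1 : 1 ≤ N := by omega
  have hN0 : (0 : ℝ) < N := by positivity
  have hNn : (n : ℝ) ≤ 8 * N := by
    have : n ≤ 8 * N := by omega
    exact_mod_cast this
  have hNδ : ((N : ℝ) ^ 2)⁻¹ ≤ δ / 2 := by
    rw [inv_le_iff_one_le_mul₀ (by positivity)]
    nlinarith [mul_self_le_mul_self hn0.le hNn]
  set u := (a + (1 - a) * δ) / 2 with hu
  have hu0 : δ / 2 ≤ u := by nlinarith
  have hu1 : u ≤ a + δ := by nlinarith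
  obtain ⟨q₁, hq₁, hq₁u, hq₁int⟩ := exists_polynomial_integral_sq_le hN1 (hNδ.trans hu0)
    (by linarith)
  obtain ⟨q₂, hq₂, hq₂δ, hq₂int⟩ := exists_polynomial_integral_sq_le hN1
    (hNδ.trans (by linarith : δ / 2 ≤ δ)) (by linarith)
  set r : MvPolynomial (Fin 2) ℝ := MvPolynomial.C (1 / 2) *
    (MvPolynomial.X 0 + MvPolynomial.C a + MvPolynomial.C (1 - a) * MvPolynomial.X 1) with hr
  have hr1 : r.totalDegree ≤ 1 := by
    have hC (x : ℝ) (s : MvPolynomial (Fin 2) ℝ) (hs : s.totalDegree ≤ 1) :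
        (MvPolynomial.C x * s).totalDegree ≤ 1 := by
      refine (MvPolynomial.totalDegree_mul _ _).trans ?_
      rw [MvPolynomial.totalDegree_C]
      omega
    refine hC _ _ ((MvPolynomial.totalDegree_add _ _).trans (max_le
      ((MvPolynomial.totalDegree_add _ _).trans (max_le ?_ ?_)) (hC _ _ ?_))) <;> simp
  have heval (z : ℝ × ℝ) : MvPolynomial.eval ![z.1, z.2]
      (Polynomial.aeval r q₁ * Polynomial.aeval (MvPolynomial.X 1) q₂) =
        q₁.eval ((z.1 + a + (1 - a) * z.2) / 2) * q₂.eval z.2 := by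
    have h (s : MvPolynomial (Fin 2) ℝ) (q : Polynomial ℝ) :
        MvPolynomial.eval ![z.1, z.2] (Polynomial.aeval s q) =
          q.eval (MvPolynomial.eval ![z.1, z.2] s) := by
      simp only [← MvPolynomial.coe_aeval_eq_eval, RingHom.coe_coe]
      rw [← Polynomial.aeval_algHom_apply, Polynomial.coe_aeval_eq_eval]
    rw [map_mul, h, h, hr]
    simp
    left
    congr 1
    ring
  refine ⟨Polynomial.aeval r q₁ * Polynomial.aeval (MvPolynomial.X 1) q₂, ?_, ?_, ?_⟩
  · refine (MvPolynomial.totalDegree_mul _ _).trans ?_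
    have h1 := totalDegree_aeval_le q₁ hr1
    have h2 := totalDegree_aeval_le q₂ (r := MvPolynomial.X 1) (by simp)
    omega
  · rw [heval (0, δ)]
    simp only [zero_add]
    rw [← hu, hq₁u, hq₂δ, one_mul]
  · simp only [heval]
    refine (setIntegral_trapezoid_le (by linarith)
      (G := fun z => (q₁.eval ((z.1 + a + (1 - a) * z.2) / 2) * q₂.eval z.2) ^ 2)
      (((q₁.continuous.comp (by fun_prop)).mul (q₂.continuous.comp continuous_snd)).pow 2)
      fun z => sq_nonneg _).trans ?_
    have heq (z : ℝ × ℝ) :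
        2 * (q₁.eval ((2 * z.1 - a - (1 - a) * z.2 + a + (1 - a) * z.2) / 2) *
          q₂.eval z.2) ^ 2 = (2 * q₁.eval z.1 ^ 2) * q₂.eval z.2 ^ 2 := by
      rw [show (2 * z.1 - a - (1 - a) * z.2 + a + (1 - a) * z.2) / 2 = z.1 by ring]
      ring
    simp only [heq]
    rw [Measure.volume_eq_prod, setIntegral_prod_mul (fun x => 2 * q₁.eval x ^ 2)
      (fun x => q₂.eval x ^ 2), integral_const_mul]
    simp only [integral_Icc_eq_integral_Ioc]
    rw [← intervalIntegral.integral_of_le zero_le_one, ← intervalIntegral.integral_of_le zero_le_one]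
    have h2 : 0 ≤ ∫ x in (0 : ℝ)..1, q₂.eval x ^ 2 :=
      intervalIntegral.integral_nonneg zero_le_one fun _ _ => sq_nonneg _
    have hpi : Real.pi ≤ 4 := Real.pi_le_four
    have hpi0 := Real.pi_pos
    calc 2 * (∫ x in (0 : ℝ)..1, q₁.eval x ^ 2) * ∫ x in (0 : ℝ)..1, q₂.eval x ^ 2
        ≤ 2 * (96 * Real.pi * √u / N) * (96 * Real.pi * √δ / N) := by gcongr
      _ ≤ 2 * (96 * 4 * √(a + δ) / (n / 8)) * (96 * 4 * √δ / (n / 8)) := by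
        gcongr <;> linarith
      _ = 18874368 * ((n : ℝ) ^ 2)⁻¹ * (√δ * √(a + δ)) := by
        field_simp
        norm_num
      _ ≤ _ := by
        gcongr
        norm_num

/-- Example 3.9: Christoffel function of the trapezoid with vertices `(±a,0)`, `(±1,1)`. -/
theorem stmt10 : ∃ c C : ℝ, 0 < c ∧ 1 ≤ C ∧ ∀ a : ℝ, 0 < a → a ≤ 1/3 →
    ∀ n : ℕ, 1 ≤ n → ∀ δ : ℝ, c * ((n:ℝ)^2)⁻¹ ≤ δ → δ ≤ 1/2 →
    C⁻¹ * ((n:ℝ)^2)⁻¹ * Real.sqrt (δ * (a + δ)) ≤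
        christoffel 2 n (e2 0 δ)
          (convexHull ℝ {e2 (-a) 0, e2 a 0, e2 (-1) 1, e2 1 1}) ∧
    christoffel 2 n (e2 0 δ)
        (convexHull ℝ {e2 (-a) 0, e2 a 0, e2 (-1) 1, e2 1 1}) ≤
      C * ((n:ℝ)^2)⁻¹ * Real.sqrt (δ * (a + δ)) := by
  refine ⟨128, 20000000, by norm_num, by norm_num, fun a ha ha1 n hn δ hδ hδ1 => ?_⟩
  have hn0 : (0 : ℝ) < n := by positivity
  have hn2 : (0 : ℝ) < ((n : ℝ) ^ 2)⁻¹ := by positivity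
  have hδ0 : 0 < δ := lt_of_lt_of_le (by positivity) hδ
  have hint (p : MvPolynomial (Fin 2) ℝ) :
      ∫ y in convexHull ℝ {e2 (-a) 0, e2 a 0, e2 (-1) 1, e2 1 1},
        (MvPolynomial.eval (fun i => y i) p) ^ 2 =
      ∫ z in trapezoid a, MvPolynomial.eval ![z.1, z.2] p ^ 2 := by
    rw [convexHull_eq_preimage_trapezoid ha, ← setIntegral_euclidean_eq (trapezoid a)
      fun z => MvPolynomial.eval ![z.1, z.2] p ^ 2]
    congr 1
    ext y
    congr 3
    ext i
    fin_cases i <;> rfl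
  have hpoint : (fun i => e2 0 δ i) = ![0, δ] := rfl
  simp only [christoffel, hint, hpoint]
  rw [Real.sqrt_mul hδ0.le]
  constructor
  · refine le_csInf ⟨_, 1, by simp, by simp, rfl⟩ ?_
    rintro _ ⟨p, hp, hp1, rfl⟩
    have h := sq_eval_le_setIntegral_trapezoid ha ha1 (by linarith) hn hδ1 hp
    rw [hp1, one_pow, one_mul, ← div_le_iff₀' (by positivity)] at h
    refine le_trans ?_ h
    rw [div_eq_inv_mul, mul_inv]
    gcongr
    norm_num
  · obtain ⟨p, hp, hp1, hple⟩ := exists_mvPolynomial_setIntegral_trapezoid_le ha ha1 hδ hn hδ1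
    refine le_trans (csInf_le ⟨0, ?_⟩ ?_) hple
    swap
    · exact ⟨p, hp, hp1, rfl⟩
    rintro _ ⟨q, -, -, rfl⟩
    exact integral_nonneg fun z => sq_nonneg _
end
end

section
/- Let D ⊆ ℝ² be a convex body with B ⊆ D ⊆ 2B, and let x ∈ D be such that x + (1/8)·B ⊆ D. Then L(x,D) ≥ 1/64 and U(x,D) ≤ 32. -/
open MeasureTheory Set Pointwise

noncomputable section

/-- The affine automorphism `y ↦ (c i * y i + v i)ᵢ` of `ℝ^d`, where all `c i` are nonzero. -/
noncomputable def diagAffineEquiv {d : ℕ} (c : Fin d → ℝ) (hc : ∀ i, c i ≠ 0) (v : E d) :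
    E d ≃ᵃ[ℝ] E d :=
  ((WithLp.linearEquiv 2 ℝ (Fin d → ℝ)) ≪≫ₗ
    (LinearEquiv.piCongrRight fun i => LinearEquiv.smulOfNeZero ℝ ℝ (c i) (hc i)) ≪≫ₗ
    (WithLp.linearEquiv 2 ℝ (Fin d → ℝ)).symm).toAffineEquiv.trans
    (AffineEquiv.constVAdd ℝ (E d) v)

lemma diagAffineEquiv_apply {d : ℕ} (c : Fin d → ℝ) (hc : ∀ i, c i ≠ 0) (v y : E d) (i : Fin d) :
    diagAffineEquiv c hc v y i = c i * y i + v i := by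
  simp [diagAffineEquiv, add_comm]

lemma diagAffineEquiv_symm_apply {d : ℕ} (c : Fin d → ℝ) (hc : ∀ i, c i ≠ 0) (v y : E d)
    (i : Fin d) : (diagAffineEquiv c hc v).symm y i = (y i - v i) / c i := by
  have h := diagAffineEquiv_apply c hc v ((diagAffineEquiv c hc v).symm y) i
  rw [AffineEquiv.apply_symm_apply] at h
  rw [h, add_sub_cancel_right, mul_div_cancel_left₀ _ (hc i)]

lemma adet_diagAffineEquiv {d : ℕ} (c : Fin d → ℝ) (hc : ∀ i, c i ≠ 0) (v : E d) :
    adet (diagAffineEquiv c hc v) = ∏ i, c i := by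
  have h : ((diagAffineEquiv c hc v).linear : E d →ₗ[ℝ] E d) =
      ((WithLp.linearEquiv 2 ℝ (Fin d → ℝ)).symm : (Fin d → ℝ) →ₗ[ℝ] E d) ∘ₗ
        Matrix.toLin' (Matrix.diagonal c) ∘ₗ
        ((WithLp.linearEquiv 2 ℝ (Fin d → ℝ)).symm.symm : E d →ₗ[ℝ] (Fin d → ℝ)) := by
    ext y i
    trans c i * y i
    · rfl
    · simp [Matrix.mulVec_diagonal]
  rw [adet, h, LinearMap.det_conj, LinearMap.det_toLin', Matrix.det_diagonal]

lemma volume_image_affineEquiv {d : ℕ} (T : E d ≃ᵃ[ℝ] E d) (s : Set (E d)) :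
    volume (T '' s) = ENNReal.ofReal |adet T| * volume s := by
  have h : T '' s = (fun y => T 0 + y) '' ((T.linear : E d →ₗ[ℝ] E d) '' s) := by
    rw [image_image]
    refine image_congr fun y _ => ?_
    have := T.map_vadd 0 y
    simpa [add_comm] using this
  rw [h, image_add_left, measure_preimage_add, Measure.addHaar_image_linearMap, adet]

lemma abs_adet_le_of_image_ballE_subset {T : E2 ≃ᵃ[ℝ] E2} {R : ℝ} (hR : 0 ≤ R)
    (hT : T '' ballE ⊆ Metric.closedBall 0 R) : |adet T| ≤ R ^ 2 := by
  have h := measure_mono (μ := volume) hT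
  rw [volume_image_affineEquiv, ballE, Measure.addHaar_closedBall' volume (0 : E2) hR] at h
  rw [Measure.addHaar_closedBall' volume (0 : E2) zero_le_one] at h
  simp only [finrank_euclideanSpace, Fintype.card_fin, one_pow, ENNReal.ofReal_one, one_mul] at h
  rw [ENNReal.mul_le_mul_iff_left (Metric.measure_closedBall_pos volume _ one_pos).ne'
    measure_closedBall_lt_top.ne] at h
  exact (ENNReal.ofReal_le_ofReal_iff (by positivity)).1 h

lemma le_Lfun {D : Set E2} {R : ℝ} (hR : 0 ≤ R) (hD : D ⊆ Metric.closedBall 0 R) {x : E2}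
    {T : E2 ≃ᵃ[ℝ] E2} (hx : x ∈ T '' ballE) (hT : T '' ballE ⊆ D) :
    Real.sqrt (1 - ‖T.symm x‖) * |adet T| ≤ Lfun x D := by
  refine le_csSup ⟨R ^ 2, ?_⟩ ⟨T, hx, hT, rfl⟩
  rintro r ⟨T', -, hT', rfl⟩
  have hs : Real.sqrt (1 - ‖T'.symm x‖) ≤ 1 := Real.sqrt_le_one.2 (by simp)
  exact (mul_le_of_le_one_left (abs_nonneg _) hs).trans
    (abs_adet_le_of_image_ballE_subset hR (hT'.trans hD))

lemma Ufun_le {D : Set E2} {x : E2} {T : E2 ≃ᵃ[ℝ] E2}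
    (hx : x ∈ T '' ((2 : ℝ)⁻¹ • squareS)) (hT : D ⊆ T '' squareS) :
    Ufun x D ≤ Real.sqrt ((T.symm x) 0 * (T.symm x) 1) * |adet T| := by
  refine csInf_le ⟨0, ?_⟩ ⟨T, hx, hT, rfl⟩
  rintro r ⟨T', -, -, rfl⟩
  positivity

lemma pow_two_le_Lfun {D : Set E2} {R ρ : ℝ} (hR : 0 ≤ R) (hρ : 0 < ρ)
    (hD : D ⊆ Metric.closedBall 0 R) {x : E2} (hx : Metric.closedBall x ρ ⊆ D) :
    ρ ^ 2 ≤ Lfun x D := by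
  set T := diagAffineEquiv (fun _ => ρ) (fun _ => hρ.ne') x with hTdef
  have hTy : ∀ y, T y = ρ • y + x := fun y => by
    ext i
    simp [hTdef, diagAffineEquiv_apply]
  have hT0 : T 0 = x := by simp [hTy]
  have hsymm : T.symm x = 0 := by rw [← hT0, AffineEquiv.symm_apply_apply]
  have h := le_Lfun (x := x) (T := T) hR hD ⟨0, by simp [ballE], hT0⟩ (by
    rintro _ ⟨y, hy, rfl⟩
    refine hx ?_
    have hy1 : ‖y‖ ≤ 1 := by simpa [ballE] using hy
    rw [hTy, mem_closedBall_iff_norm, add_sub_cancel_right, norm_smul, Real.norm_of_nonneg hρ.le]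
    nlinarith)
  rw [hsymm, hTdef, adet_diagAffineEquiv] at h
  simpa using h

lemma mem_smul_squareS {a : ℝ} (ha : 0 < a) {y : E2} :
    y ∈ a • squareS ↔ ∀ i, 0 ≤ y i ∧ y i ≤ a := by
  rw [mem_smul_set_iff_inv_smul_mem₀ ha.ne', Fin.forall_fin_two]
  simp [squareS, ha, inv_mul_le_iff₀]

lemma exists_reflection_coefficient {R t : ℝ} (hR : 0 < R) (ht : |t| ≤ R) :
    ∃ c : ℝ, |c| = 2 * R ∧ 0 ≤ (t + c / 2) / c ∧ (t + c / 2) / c ≤ 2⁻¹ := by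
  obtain ⟨h1, h2⟩ := abs_le.1 ht
  rcases le_total t 0 with h | h
  · refine ⟨2 * R, abs_of_pos (by positivity), div_nonneg (by linarith) (by positivity), ?_⟩
    rw [div_le_iff₀ (by positivity)]
    linarith
  · refine ⟨-(2 * R), by rw [abs_neg, abs_of_pos (by positivity)],
      div_nonneg_of_nonpos (by linarith) (by linarith), ?_⟩
    rw [div_le_iff_of_neg (by linarith)]
    linarith

lemma Ufun_le_two_mul_pow_two {D : Set E2} {R : ℝ} (hR : 0 < R)
    (hD : D ⊆ Metric.closedBall 0 R) {x : E2} (hx : x ∈ D) : Ufun x D ≤ 2 * R ^ 2 := by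
  have hcoord : ∀ y ∈ D, ∀ i, |y i| ≤ R := fun y hy i =>
    (PiLp.norm_apply_le y i).trans (mem_closedBall_zero_iff.1 (hD hy))
  choose c hc hc0 hc1 using fun i => exists_reflection_coefficient hR (hcoord x hx i)
  have hcne : ∀ i, c i ≠ 0 := fun i => abs_pos.1 (by rw [hc]; positivity)
  set v : E2 := WithLp.toLp 2 fun i => -(c i / 2) with hv
  set T := diagAffineEquiv c hcne v with hTdef
  have hsymm : ∀ y i, T.symm y i = (y i + c i / 2) / c i := fun y i => by
    simp [hTdef, diagAffineEquiv_symm_apply, hv]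
  have hsq : ∀ y ∈ D, ∀ i, 0 ≤ T.symm y i ∧ T.symm y i ≤ 1 := fun y hy i => by
    obtain ⟨h1, h2⟩ := abs_le.1 (hcoord y hy i)
    rw [hsymm]
    rcases (abs_eq (by positivity)).1 (hc i) with h | h <;> rw [h]
    · exact ⟨div_nonneg (by linarith) (by positivity), (div_le_one (by positivity)).2 (by linarith)⟩
    · exact ⟨div_nonneg_of_nonpos (by linarith) (by linarith),
        (div_le_one_of_neg (by linarith)).2 (by linarith)⟩
  have hxsq : ∀ i, 0 ≤ T.symm x i ∧ T.symm x i ≤ 2⁻¹ := fun i => by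
    rw [hsymm]
    exact ⟨hc0 i, hc1 i⟩
  have h := Ufun_le (x := x) (T := T)
    ⟨T.symm x, (mem_smul_squareS (by norm_num)).2 hxsq, T.apply_symm_apply x⟩
    (fun y hy => ⟨T.symm y, ⟨hsq y hy 0, hsq y hy 1⟩, T.apply_symm_apply y⟩)
  have hdet : |adet T| = (2 * R) * (2 * R) := by
    rw [hTdef, adet_diagAffineEquiv, Fin.prod_univ_two, abs_mul, hc, hc]
  have hs : Real.sqrt (T.symm x 0 * T.symm x 1) ≤ 2⁻¹ := by
    refine Real.sqrt_le_iff.2 ⟨by norm_num, ?_⟩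
    rw [sq]
    exact mul_le_mul (hxsq 0).2 (hxsq 1).2 (hxsq 1).1 (by norm_num)
  rw [hdet] at h
  nlinarith [mul_le_mul_of_nonneg_right hs (show 0 ≤ (2 * R) * (2 * R) by positivity)]

/-- Case 1 of the proof of Theorem 2.1: interior points far from the boundary. -/
theorem stmt15 (D : Set E2) (hD : IsConvexBody D)
    (hB : Metric.closedBall (0:E2) 1 ⊆ D) (h2B : D ⊆ Metric.closedBall (0:E2) 2)
    (x : E2) (hx : x ∈ D) (hball : Metric.closedBall x (1/8) ⊆ D) :
    1/64 ≤ Lfun x D ∧ Ufun x D ≤ 32 := by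
  constructor
  · have h := pow_two_le_Lfun zero_le_two (by norm_num) h2B hball
    norm_num at h ⊢
    exact h
  · exact (Ufun_le_two_mul_pow_two two_pos h2B hx).trans (by norm_num)
end
end

section
/- Let D ⊆ ℝ² be a convex body with B ⊆ D ⊆ 2B, let x be an interior point of D with x ≠ 0, and let δ > 0 be such that x·(1 + δ/‖x‖) lies on the boundary of D. If x + (1/8)·B is not contained in D, then δ < 1/4. -/
open MeasureTheory Set Pointwise

noncomputable section

/-- If `x + (1/8)B ⊄ D` then the boundary parameter `δ` satisfies `δ < 1/4`. -/
theorem stmt16 (D : Set E2) (hD : IsConvexBody D)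
    (hB : Metric.closedBall (0:E2) 1 ⊆ D) (h2B : D ⊆ Metric.closedBall (0:E2) 2)
    (x : E2) (hx : x ∈ interior D) (hx0 : x ≠ 0) (δ : ℝ) (hδ : 0 < δ)
    (hbd : (1 + δ / ‖x‖) • x ∈ frontier D)
    (hnot : ¬ Metric.closedBall x (1/8) ⊆ D) : δ < 1/4 := by
  by_contra! hle
  refine hnot fun w hw => ?_
  have hn : 0 < ‖x‖ := norm_pos_iff.mpr hx0
  have hr : 0 < ‖x‖ + δ := by positivity
  have hz : (1 + δ / ‖x‖) • x ∈ D := hD.2.1.isClosed.frontier_subset hbd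
  have hr2 : ‖x‖ + δ ≤ 2 := by
    have h := mem_closedBall_zero_iff.mp (h2B hz)
    rwa [norm_smul, Real.norm_of_nonneg (by positivity), add_mul, one_mul,
      div_mul_cancel₀ _ hn.ne'] at h
  have hw' : ‖w - x‖ ≤ 1 / 8 := mem_closedBall_iff_norm.mp hw
  have hu : ((‖x‖ + δ) / δ) • (w - x) ∈ D := by
    refine hB (mem_closedBall_zero_iff.mpr ?_)
    rw [norm_smul, Real.norm_of_nonneg (by positivity), div_mul_eq_mul_div, div_le_one hδ]
    nlinarith [norm_nonneg (w - x)]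
  have hsum : ‖x‖ / (‖x‖ + δ) + δ / (‖x‖ + δ) = 1 := by field_simp
  have hmem := hD.1 hz hu (by positivity) (by positivity) hsum
  have hcx : ‖x‖ / (‖x‖ + δ) * (1 + δ / ‖x‖) = 1 := by field_simp
  have hcw : δ / (‖x‖ + δ) * ((‖x‖ + δ) / δ) = 1 := by field_simp
  rwa [smul_smul, smul_smul, hcx, hcw, one_smul, one_smul, add_sub_cancel] at hmem
end
end

section
/- Let D′ ⊆ ℝ² be a convex body with D′ ⊆ [−16,16]×[0,16], and let δ ∈ (0,8] be such that the point (0,δ) lies in the interior of D′. Then U((0,δ), D′) ≤ 64·√(2δ). -/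
open MeasureTheory Set Pointwise

noncomputable section

/-- The diagonal linear automorphism `(u, v) ↦ (a u, b v)` of `ℝ²`. -/
def diagLinear (a b : ℝ) (ha : a ≠ 0) (hb : b ≠ 0) : E2 ≃ₗ[ℝ] E2 where
  toFun p := !₂[a * p 0, b * p 1]
  invFun p := !₂[a⁻¹ * p 0, b⁻¹ * p 1]
  map_add' p q := by ext i; fin_cases i <;> simp [mul_add]
  map_smul' c p := by ext i; fin_cases i <;> simp [mul_left_comm]
  left_inv p := by ext i; fin_cases i <;> simp [ha, hb]
  right_inv p := by ext i; fin_cases i <;> simp [ha, hb]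

theorem det_diagLinear (a b : ℝ) (ha : a ≠ 0) (hb : b ≠ 0) :
    LinearMap.det (diagLinear a b ha hb : E2 →ₗ[ℝ] E2) = a * b := by
  rw [← LinearMap.det_toMatrix (EuclideanSpace.basisFun (Fin 2) ℝ).toBasis, Matrix.det_fin_two]
  simp [LinearMap.toMatrix_apply, diagLinear]

/-- The affine automorphism of `ℝ²` that maps the unit square onto `[-16,16]×[0,16]`. -/
def boxMap : E2 ≃ᵃ[ℝ] E2 :=
  (diagLinear 32 16 (by norm_num) (by norm_num)).toAffineEquiv.trans
    (AffineEquiv.constVAdd ℝ E2 (!₂[-16, 0] : E2))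

theorem boxMap_apply (p : E2) : boxMap p = !₂[32 * p 0 - 16, 16 * p 1] := by
  ext i; fin_cases i <;> simp [boxMap, diagLinear]
  ring

theorem boxMap_symm_apply (p : E2) : boxMap.symm p = !₂[(p 0 + 16) / 32, p 1 / 16] := by
  rw [AffineEquiv.symm_apply_eq, boxMap_apply]
  ext i; fin_cases i <;> simp <;> ring

theorem adet_boxMap : adet boxMap = 512 := by
  have h : boxMap.linear = diagLinear 32 16 (by norm_num) (by norm_num) := rfl
  rw [adet, h, det_diagLinear]
  norm_num

/-- Bound (2.11): `U((0,δ), D′) ≤ 64·√(2δ)` for `D′ ⊆ [−16,16]×[0,16]`. -/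
theorem stmt18 (D' : Set E2) (hD : IsConvexBody D')
    (hsub : D' ⊆ {p : E2 | p 0 ∈ Icc (-16:ℝ) 16 ∧ p 1 ∈ Icc (0:ℝ) 16})
    (δ : ℝ) (hδ0 : 0 < δ) (hδ8 : δ ≤ 8) (hin : e2 0 δ ∈ interior D') :
    Ufun (e2 0 δ) D' ≤ 64 * Real.sqrt (2 * δ) := by
  refine csInf_le ⟨0, ?_⟩ ⟨boxMap, ?_, ?_, ?_⟩
  · rintro r ⟨T, -, -, rfl⟩
    positivity
  · refine ⟨boxMap.symm (e2 0 δ), ?_, by simp⟩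
    rw [mem_smul_set_iff_inv_smul_mem₀ (by norm_num), boxMap_symm_apply]
    simp only [squareS, mem_ofPred_eq, mem_Icc, e2]
    norm_num
    constructor <;> linarith
  · intro p hp
    obtain ⟨⟨h1, h2⟩, h3, h4⟩ := hsub hp
    refine ⟨boxMap.symm p, ?_, by simp⟩
    rw [boxMap_symm_apply]
    simp only [squareS, mem_ofPred_eq, mem_Icc, Matrix.cons_val_zero,
      Matrix.cons_val_one]
    refine ⟨⟨?_, ?_⟩, ?_, ?_⟩ <;> linarith
  · have h : (boxMap.symm (e2 0 δ)) 0 * (boxMap.symm (e2 0 δ)) 1 = (2 * δ) / 8 ^ 2 := by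
      rw [boxMap_symm_apply]
      simp [e2]
      ring
    rw [h, adet_boxMap, Real.sqrt_div' _ (by norm_num), Real.sqrt_sq (by norm_num),
      abs_of_pos (by norm_num)]
    ring
end
end
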